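/- Let m ≥ 2 and n = k(m−1) + m for some integer k ≥ 1, and let G ≤ Sym(m). Let H ≤ Sym(n) be the extended group G_ext = {σ' : σ ∈ G}, where for σ ∈ Sym(m) the permutation σ' ∈ Sym(n) agrees with σ on {0,…,m−1} and fixes each of m, m+1, …, n−1. Then there exists an injective group homomorphism from V_m(G) into V_n(H). -/

import Mathlib

namespace Paper

/-- Concatenation of a finite word with an infinite word. -/
def cat {n : ℕ} (w : List (Fin n)) (ζ : ℕ → Fin n) : ℕ → Fin n :=
  fun i => if h : i < w.length then w[i]'h else ζ (i - w.length)

/-- The finite word `w` is a prefix of the infinite word `ζ`. -/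
def IsPref {n : ℕ} (w : List (Fin n)) (ζ : ℕ → Fin n) : Prop :=
  ∀ (i : ℕ) (h : i < w.length), w[i]'h = ζ i

/-- An indexed family of finite words is a complete prefix code: every infinite
word has exactly one member of the family as a prefix. -/
def IsCPC {n : ℕ} {ι : Type} (P : ι → List (Fin n)) : Prop :=
  ∀ ζ : ℕ → Fin n, ∃! i : ι, IsPref (P i) ζ

/-- `f` is the map described by the table with domain code `P`, range code `Q` and
permutations `σ, τ`: it sends `pᵢ‖σᵢ(u)` to `qᵢ‖τᵢ(u)`. -/
def TableFun {n : ℕ} {ι : Type} (P Q : ι → List (Fin n))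
    (σ τ : ι → Equiv.Perm (Fin n)) (f : (ℕ → Fin n) → (ℕ → Fin n)) : Prop :=
  ∀ (i : ι) (u : ℕ → Fin n),
    f (cat (P i) (fun j => σ i (u j))) = cat (Q i) (fun j => τ i (u j))

/-- A table over a subgroup `H ≤ Sym(n)`. -/
structure Table (n : ℕ) (H : Subgroup (Equiv.Perm (Fin n))) where
  k : ℕ
  P : Fin k → List (Fin n)
  Q : Fin k → List (Fin n)
  σ : Fin k → Equiv.Perm (Fin n)
  τ : Fin k → Equiv.Perm (Fin n)
  σ_mem : ∀ i, σ i ∈ H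
  τ_mem : ∀ i, τ i ∈ H
  hP : IsCPC P
  hQ : IsCPC Q

/-- The table `T` induces the map `f`. -/
def Induces {n : ℕ} {H : Subgroup (Equiv.Perm (Fin n))} (T : Table n H)
    (f : (ℕ → Fin n) → (ℕ → Fin n)) : Prop :=
  TableFun T.P T.Q T.σ T.τ f

/-- The symmetric Thompson group `V_n(H)`, as the set of homeomorphisms of the
Cantor space `C_n = A_n^ℕ` induced by tables over `H`. -/
def Vset (n : ℕ) (H : Subgroup (Equiv.Perm (Fin n))) :
    Set ((ℕ → Fin n) ≃ₜ (ℕ → Fin n)) :=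
  { f | ∃ T : Table n H, Induces T ⇑f }

section Words

variable {n : ℕ}

theorem cat_nil (ζ : ℕ → Fin n) : cat [] ζ = ζ := by
  funext i
  simp [cat]

theorem cat_append (v w : List (Fin n)) (ζ : ℕ → Fin n) :
    cat (v ++ w) ζ = cat v (cat w ζ) := by
  funext i
  simp only [cat, List.length_append, List.getElem_append]
  split_ifs <;> first | rfl | omega | (congr 1; omega)

theorem cat_apply_add (w : List (Fin n)) (ζ : ℕ → Fin n) (i : ℕ) :
    cat w ζ (w.length + i) = ζ i := by
  simp [cat]

theorem cat_apply_of_lt (w : List (Fin n)) (ζ : ℕ → Fin n) {i : ℕ} (h : i < w.length) :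
    cat w ζ i = w[i] := by
  simp [cat, h]

theorem cat_injective (w : List (Fin n)) : Function.Injective (cat w) := by
  intro ζ ξ h
  funext i
  rw [← cat_apply_add w ζ, h, cat_apply_add]

theorem eq_of_cat_eq {v w : List (Fin n)} {ζ ξ : ℕ → Fin n} (hl : v.length = w.length)
    (h : cat v ζ = cat w ξ) : v = w := by
  refine List.ext_getElem hl fun i h₁ h₂ => ?_
  rw [← cat_apply_of_lt v ζ h₁, h, cat_apply_of_lt w ξ h₂]

theorem comp_cat {m : ℕ} (f : Fin n → Fin m) (w : List (Fin n)) (ζ : ℕ → Fin n) :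
    f ∘ cat w ζ = cat (w.map f) (f ∘ ζ) := by
  funext i
  simp only [cat, Function.comp_apply, List.length_map, List.getElem_map]
  split_ifs <;> rfl

theorem cat_ofFn (N : ℕ) (ζ : ℕ → Fin n) :
    cat (List.ofFn fun i : Fin N => ζ i) (fun i => ζ (N + i)) = ζ := by
  funext i
  simp only [cat, List.length_ofFn, List.getElem_ofFn]
  split_ifs with h
  · rfl
  · congr 1
    omega

theorem isPref_iff {w : List (Fin n)} {ζ : ℕ → Fin n} :
    IsPref w ζ ↔ ∃ u, cat w u = ζ := by
  constructor
  · intro h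
    refine ⟨fun i => ζ (w.length + i), ?_⟩
    funext i
    simp only [cat]
    split_ifs with hi
    · exact h i hi
    · congr 1
      omega
  · rintro ⟨u, rfl⟩ i hi
    exact (cat_apply_of_lt w u hi).symm

theorem continuous_cat (w : List (Fin n)) : Continuous (cat w) := by
  refine continuous_pi fun i => ?_
  by_cases h : i < w.length
  · simpa [cat, h] using continuous_const
  · simpa [cat, h] using continuous_apply (i - w.length)

theorem isOpen_isPref (w : List (Fin n)) : IsOpen {ζ : ℕ → Fin n | IsPref w ζ} := by
  have : {ζ : ℕ → Fin n | IsPref w ζ} = ⋂ i : Fin w.length, {ζ | ζ i = w[i]} := by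
    ext ζ
    simp only [IsPref, Set.mem_ofPred_eq, Set.mem_iInter]
    exact ⟨fun h i => (h i i.2).symm, fun h i hi => (h ⟨i, hi⟩).symm⟩
  rw [this]
  refine isOpen_iInter_of_finite fun i => ?_
  exact (isOpen_discrete ({w[i]} : Set (Fin n))).preimage
    (continuous_apply (A := fun _ : ℕ => Fin n) (i : ℕ))

/-- If two words prefix the same infinite word, the shorter one prefixes the longer one. -/
theorem exists_append_of_cat_eq {v w : List (Fin n)} {ζ ξ : ℕ → Fin n}
    (hl : v.length ≤ w.length) (h : cat v ζ = cat w ξ) :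
    ∃ x, w = v ++ x ∧ ζ = cat x ξ := by
  have hw : w = v ++ w.drop v.length := by
    conv_lhs => rw [← List.take_append_drop v.length w]
    congr 1
    refine (eq_of_cat_eq (ζ := ζ) (ξ := cat (w.drop v.length) ξ) (by simpa using hl) ?_).symm
    rw [← cat_append, List.take_append_drop, h]
  refine ⟨w.drop v.length, hw, cat_injective v ?_⟩
  rw [← cat_append, ← hw, h]

end Words

section Local

variable {n : ℕ}

/-- Every point has a neighbourhood cone on which `h` replaces one prefix by another. -/
def IsLocal (h : (ℕ → Fin n) → (ℕ → Fin n)) : Prop :=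
  ∀ ζ, ∃ p q, IsPref p ζ ∧ ∀ u, h (cat p u) = cat q u

theorem IsLocal.continuous {h : (ℕ → Fin n) → (ℕ → Fin n)} (hh : IsLocal h) :
    Continuous h := by
  refine continuous_iff_continuousAt.2 fun ζ => ?_
  obtain ⟨p, q, hp, hpq⟩ := hh ζ
  have hc : Continuous fun ξ : ℕ → Fin n => cat q fun i => ξ (p.length + i) :=
    (continuous_cat q).comp (continuous_pi fun i => continuous_apply _)
  refine hc.continuousAt.congr ?_
  filter_upwards [(isOpen_isPref p).mem_nhds hp] with ξ hξ
  obtain ⟨u, rfl⟩ := isPref_iff.1 hξ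
  rw [hpq]
  congr 1
  funext i
  exact cat_apply_add p u i

theorem IsLocal.exists_uniform {h : (ℕ → Fin n) → (ℕ → Fin n)} (hh : IsLocal h) :
    ∃ N, ∀ ζ : ℕ → Fin n, ∃ q, ∀ u, h (cat (List.ofFn fun i : Fin N => ζ i) u) = cat q u := by
  choose p q hp hpq using hh
  obtain ⟨t, ht⟩ := isCompact_univ.elim_finite_subcover
    (fun ζ => {ξ : ℕ → Fin n | IsPref (p ζ) ξ}) (fun ζ => isOpen_isPref _)
    (fun ζ _ => Set.mem_iUnion.2 ⟨ζ, hp ζ⟩)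
  refine ⟨t.sup fun ζ => (p ζ).length, fun ξ => ?_⟩
  obtain ⟨ζ, hζ, hξ⟩ := Set.mem_iUnion₂.1 (ht (Set.mem_univ ξ))
  obtain ⟨u, hu⟩ := isPref_iff.1 hξ
  have hle : (p ζ).length ≤ t.sup fun ζ => (p ζ).length :=
    Finset.le_sup (f := fun ζ => (p ζ).length) hζ
  obtain ⟨x, hx, -⟩ := exists_append_of_cat_eq (by simpa using hle)
    (hu.trans (cat_ofFn (t.sup fun ζ => (p ζ).length) ξ).symm)
  refine ⟨q ζ ++ x, fun v => ?_⟩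
  rw [hx, cat_append, hpq, cat_append]

theorem IsLocal.mem_Vset {h : (ℕ → Fin n) ≃ₜ (ℕ → Fin n)} (hh : IsLocal h)
    (H : Subgroup (Equiv.Perm (Fin n))) : h ∈ Vset n H := by
  obtain ⟨N, hN⟩ := IsLocal.exists_uniform hh
  rcases isEmpty_or_nonempty (Fin n) with hn | ⟨⟨c⟩⟩
  · refine ⟨⟨0, Fin.elim0, Fin.elim0, 1, 1, fun i => i.elim0, fun i => i.elim0,
      fun ζ => (hn.false (ζ 0)).elim, fun ζ => (hn.false (ζ 0)).elim⟩, fun i => i.elim0⟩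
  let e := Fintype.equivFin (Fin N → Fin n)
  have hN' : ∀ w : Fin N → Fin n, ∃ q, ∀ u, h (cat (List.ofFn w) u) = cat q u := by
    intro w
    obtain ⟨q, hq⟩ := hN (cat (List.ofFn w) fun _ => c)
    refine ⟨q, fun u => ?_⟩
    rw [← hq]
    congr 3
    funext i
    rw [cat_apply_of_lt _ _ (by simp), List.getElem_ofFn]
  choose Q hQ using hN'
  refine ⟨⟨_, fun i => List.ofFn (e.symm i), fun i => Q (e.symm i), 1, 1,
    fun _ => H.one_mem, fun _ => H.one_mem, ?_, ?_⟩, fun i u => hQ _ u⟩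
  · intro ζ
    refine ⟨e fun i => ζ i, ?_, ?_⟩
    · refine isPref_iff.2 ⟨fun i => ζ (N + i), ?_⟩
      simpa using cat_ofFn N ζ
    · intro i hi
      obtain ⟨u, hu⟩ := isPref_iff.1 hi
      have := eq_of_cat_eq (by simp) (hu.trans (cat_ofFn N ζ).symm)
      rw [← List.ofFn_injective this, e.apply_symm_apply]
  · intro ζ
    have key := cat_ofFn N (h.symm ζ)
    refine ⟨e fun i => h.symm ζ i, ?_, ?_⟩
    · refine isPref_iff.2 ⟨fun i => h.symm ζ (N + i), ?_⟩
      simp only [Equiv.symm_apply_apply]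
      rw [← hQ, key, h.apply_symm_apply]
    · intro i hi
      obtain ⟨u, hu⟩ := isPref_iff.1 hi
      simp only [← hQ] at hu
      rw [← h.eq_symm_apply] at hu
      have := eq_of_cat_eq (by simp) (hu.trans key.symm)
      rw [← List.ofFn_injective this, e.apply_symm_apply]

end Local

section Charts

variable {m : ℕ}

/-- On the cone of `p`, the map `f` is `p‖u ↦ q‖ρ(u)`. -/
def IsChart (f : (ℕ → Fin m) → (ℕ → Fin m)) (p q : List (Fin m))
    (ρ : Equiv.Perm (Fin m)) : Prop :=
  ∀ u, f (cat p u) = cat q (ρ ∘ u)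

/-- The map `f` has a chart on every cone of some fixed depth. -/
def HasCharts (f : (ℕ → Fin m) → (ℕ → Fin m)) : Prop :=
  ∃ N, ∀ p : List (Fin m), p.length = N → ∃ q ρ, IsChart f p q ρ

theorem IsChart.append {f : (ℕ → Fin m) → (ℕ → Fin m)} {p q : List (Fin m)}
    {ρ : Equiv.Perm (Fin m)} (h : IsChart f p q ρ) (w : List (Fin m)) :
    IsChart f (p ++ w) (q ++ w.map ρ) ρ := by
  intro u
  rw [cat_append, h, comp_cat, cat_append]

theorem IsChart.comp {f g : (ℕ → Fin m) → (ℕ → Fin m)} {p q r : List (Fin m)}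
    {ρ ρ' : Equiv.Perm (Fin m)} (h : IsChart f p q ρ) (h' : IsChart g q r ρ') :
    IsChart (g ∘ f) p r (ρ' * ρ) := by
  intro u
  rw [Function.comp_apply, h, h']
  rfl

theorem HasCharts.of_le {f : (ℕ → Fin m) → (ℕ → Fin m)} (h : HasCharts f) :
    ∃ N, ∀ p : List (Fin m), N ≤ p.length → ∃ q ρ, IsChart f p q ρ ∧ p.length ≤ q.length + N := by
  obtain ⟨N, hN⟩ := h
  refine ⟨N, fun p hp => ?_⟩
  obtain ⟨q, ρ, hq⟩ := hN (p.take N) (by simpa using hp)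
  have := hq.append (p.drop N)
  rw [List.take_append_drop] at this
  refine ⟨_, ρ, this, ?_⟩
  simp
  omega

theorem HasCharts.comp {f g : (ℕ → Fin m) → (ℕ → Fin m)} (hf : HasCharts f)
    (hg : HasCharts g) : HasCharts (g ∘ f) := by
  obtain ⟨N, hN⟩ := hf.of_le
  obtain ⟨M, hM⟩ := hg.of_le
  refine ⟨N + M, fun p hp => ?_⟩
  obtain ⟨q, ρ, hc, hq⟩ := hN p (by omega)
  obtain ⟨r, ρ', hc', -⟩ := hM q (by omega)
  exact ⟨r, ρ' * ρ, hc.comp hc'⟩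

theorem hasCharts_of_mem_Vset [NeZero m] {G : Subgroup (Equiv.Perm (Fin m))}
    {f : (ℕ → Fin m) ≃ₜ (ℕ → Fin m)} (hf : f ∈ Vset m G) : HasCharts f := by
  obtain ⟨T, hT⟩ := hf
  refine ⟨Finset.univ.sup fun i => (T.P i).length, fun w hw => ?_⟩
  obtain ⟨i, hi, -⟩ := T.hP (cat w fun _ => 0)
  obtain ⟨u, hu⟩ := isPref_iff.1 hi
  have hle : (T.P i).length ≤ w.length := by
    rw [hw]
    exact Finset.le_sup (f := fun i => (T.P i).length) (Finset.mem_univ i)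
  obtain ⟨x, rfl, -⟩ := exists_append_of_cat_eq hle hu
  have hc : IsChart f (T.P i) (T.Q i) (T.τ i * (T.σ i)⁻¹) := by
    intro v
    have := hT i (⇑(T.σ i)⁻¹ ∘ v)
    simpa [Function.comp_def] using this
  exact ⟨_, _, hc.append x⟩

theorem symm_mem_Vset {G : Subgroup (Equiv.Perm (Fin m))}
    {f : (ℕ → Fin m) ≃ₜ (ℕ → Fin m)} (hf : f ∈ Vset m G) : f.symm ∈ Vset m G := by
  obtain ⟨T, hT⟩ := hf
  refine ⟨⟨T.k, T.Q, T.P, T.τ, T.σ, T.τ_mem, T.σ_mem, T.hQ, T.hP⟩, fun i u => ?_⟩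
  change f.symm (cat (T.Q i) _) = cat (T.P i) _
  rw [f.symm_apply_eq]
  exact (hT i u).symm

/-- A chart is determined by its domain. -/
theorem chart_unique (hm : 2 ≤ m) {q q' : List (Fin m)} {ρ ρ' : Equiv.Perm (Fin m)}
    (h : ∀ u : ℕ → Fin m, cat q (ρ ∘ u) = cat q' (ρ' ∘ u)) : q = q' ∧ ρ = ρ' := by
  have : Nontrivial (Fin m) := Fin.nontrivial_iff_two_le.2 hm
  have aux : ∀ {q q' : List (Fin m)} {ρ ρ' : Equiv.Perm (Fin m)},
      (∀ u : ℕ → Fin m, cat q (ρ ∘ u) = cat q' (ρ' ∘ u)) → q'.length ≤ q.length := by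
    intro q q' ρ ρ' h
    by_contra! hlt
    obtain ⟨a, b, hab⟩ := exists_pair_ne (Fin m)
    have key : ∀ c, ρ c = q'[q.length] := by
      intro c
      have := congrFun (h fun _ => c) q.length
      rw [cat_apply_of_lt q' _ hlt] at this
      simpa using (cat_apply_add q (ρ ∘ fun _ => c) 0).symm.trans this
    exact hab (ρ.injective ((key a).trans (key b).symm))
  have hq : q = q' := eq_of_cat_eq (le_antisymm (aux fun u => (h u).symm) (aux h))
    (h fun _ => ⟨0, by omega⟩)
  subst hq
  refine ⟨rfl, Equiv.ext fun c => ?_⟩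
  exact congrFun (cat_injective q (h fun _ => c)) 0

end Charts

section SelfSimilar

variable {m : ℕ} {Y : Type*}

/-- The composite of the maps `step a` along a finite word. -/
def along (step : Fin m → Y → Y) (w : List (Fin m)) (y : Y) : Y :=
  w.foldr step y

theorem along_append (step : Fin m → Y → Y) (v w : List (Fin m)) (y : Y) :
    along step (v ++ w) y = along step v (along step w y) :=
  List.foldr_append

variable [MulAction (Equiv.Perm (Fin m)) Y]

/-- The maps `step a` split `Y` into `m` disjoint copies of itself, and do so equivariantly. -/
structure IsSelfSimilar (step : Fin m → Y → Y) : Prop where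
  inj : ∀ {a b y z}, step a y = step b z → a = b ∧ y = z
  surj : ∀ y, ∃ a z, step a z = y
  smul : ∀ (ρ : Equiv.Perm (Fin m)) a y, ρ • step a y = step (ρ a) (ρ • y)

/-- The pairs `(y, y')` such that `y'` is the image of `y` under some chart of `f`. -/
def ChartRel (step : Fin m → Y → Y) (f : (ℕ → Fin m) → (ℕ → Fin m)) (y y' : Y) : Prop :=
  ∃ p q ρ t, IsChart f p q ρ ∧ along step p t = y ∧ along step q (ρ • t) = y'

open Classical in
/-- The map of `Y` defined by the charts of `f`. -/
noncomputable def induced (step : Fin m → Y → Y) (f : (ℕ → Fin m) → (ℕ → Fin m)) (y : Y) : Y :=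
  if h : ∃ y', ChartRel step f y y' then h.choose else y

variable {step : Fin m → Y → Y}

namespace IsSelfSimilar

theorem smul_along (hs : IsSelfSimilar step) (ρ : Equiv.Perm (Fin m)) (w : List (Fin m)) (y : Y) :
    ρ • along step w y = along step (w.map ρ) (ρ • y) := by
  induction w with
  | nil => rfl
  | cons a w ih =>
    change ρ • step a (along step w y) = step (ρ a) (along step (w.map ρ) (ρ • y))
    rw [hs.smul, ih]

theorem exists_along (hs : IsSelfSimilar step) (N : ℕ) (y : Y) :
    ∃ w z, w.length = N ∧ along step w z = y := by
  induction N generalizing y with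
  | zero => exact ⟨[], y, rfl, rfl⟩
  | succ N ih =>
    obtain ⟨a, z, rfl⟩ := hs.surj y
    obtain ⟨w, z, rfl, rfl⟩ := ih z
    exact ⟨a :: w, z, rfl, rfl⟩

theorem comparable (hs : IsSelfSimilar step) {v w : List (Fin m)} {y z : Y}
    (h : along step v y = along step w z) :
    (∃ x, w = v ++ x ∧ y = along step x z) ∨ ∃ x, v = w ++ x ∧ z = along step x y := by
  induction v generalizing w with
  | nil => exact .inl ⟨w, rfl, h⟩
  | cons a v ih =>
    cases w with
    | nil => exact .inr ⟨a :: v, rfl, h.symm⟩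
    | cons b w =>
      obtain ⟨rfl, h'⟩ := hs.inj h
      rcases ih h' with ⟨x, rfl, hx⟩ | ⟨x, rfl, hx⟩
      · exact .inl ⟨x, rfl, hx⟩
      · exact .inr ⟨x, rfl, hx⟩

theorem chartRel_unique (hs : IsSelfSimilar step) (hm : 2 ≤ m)
    {f : (ℕ → Fin m) → (ℕ → Fin m)} {y z z' : Y}
    (h : ChartRel step f y z) (h' : ChartRel step f y z') : z = z' := by
  have aux : ∀ {p q x q' : List (Fin m)} {ρ ρ' : Equiv.Perm (Fin m)} {t : Y},
      IsChart f p q ρ → IsChart f (p ++ x) q' ρ' →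
      along step q (ρ • along step x t) = along step q' (ρ' • t) := by
    intro p q x q' ρ ρ' t hc hc'
    obtain ⟨rfl, rfl⟩ := chart_unique hm fun u => (hc.append x u).symm.trans (hc' u)
    rw [along_append, hs.smul_along]
  obtain ⟨p, q, ρ, t, hc, rfl, rfl⟩ := h
  obtain ⟨p', q', ρ', t', hc', ht, rfl⟩ := h'
  rcases hs.comparable ht with ⟨x, rfl, rfl⟩ | ⟨x, rfl, rfl⟩
  · exact (aux hc' hc).symm
  · exact aux hc hc'

theorem induced_along (hs : IsSelfSimilar step) (hm : 2 ≤ m)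
    {f : (ℕ → Fin m) → (ℕ → Fin m)} {p q : List (Fin m)} {ρ : Equiv.Perm (Fin m)}
    (h : IsChart f p q ρ) (t : Y) :
    induced step f (along step p t) = along step q (ρ • t) := by
  have hr : ChartRel step f (along step p t) (along step q (ρ • t)) :=
    ⟨p, q, ρ, t, h, rfl, rfl⟩
  have he : ∃ y', ChartRel step f (along step p t) y' := ⟨_, hr⟩
  rw [induced, dif_pos he]
  exact hs.chartRel_unique hm he.choose_spec hr

theorem induced_id (hs : IsSelfSimilar step) (hm : 2 ≤ m) (y : Y) : induced step id y = y := by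
  have := hs.induced_along hm (f := id) (p := []) (q := []) (ρ := 1) (fun _ => rfl) y
  simpa [along] using this

theorem induced_comp (hs : IsSelfSimilar step) (hm : 2 ≤ m)
    {f g : (ℕ → Fin m) → (ℕ → Fin m)} (hf : HasCharts f) (hg : HasCharts g) (y : Y) :
    induced step (g ∘ f) y = induced step g (induced step f y) := by
  obtain ⟨N, hN⟩ := hf.of_le
  obtain ⟨M, hM⟩ := hg.of_le
  obtain ⟨p, t, hp, rfl⟩ := hs.exists_along (N + M) y
  obtain ⟨q, ρ, hc, hq⟩ := hN p (by omega)
  obtain ⟨r, ρ', hc', -⟩ := hM q (by omega)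
  rw [hs.induced_along hm (hc.comp hc'), hs.induced_along hm hc, hs.induced_along hm hc', mul_smul]

theorem eq_of_induced_eq (hs : IsSelfSimilar step) (hm : 2 ≤ m) [Nonempty Y]
    {f g : (ℕ → Fin m) → (ℕ → Fin m)} (hf : HasCharts f) (hg : HasCharts g)
    (h : induced step f = induced step g) : f = g := by
  obtain ⟨t⟩ := ‹Nonempty Y›
  obtain ⟨N, hN⟩ := hf.of_le
  obtain ⟨M, hM⟩ := hg.of_le
  have aux : ∀ {v w : List (Fin m)} {a b : Y} {ζ ξ : ℕ → Fin m} {i : ℕ},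
      i < v.length → i < w.length → along step v a = along step w b →
      cat v ζ i = cat w ξ i := by
    intro v w a b ζ ξ i hv hw he
    rw [cat_apply_of_lt _ _ hv, cat_apply_of_lt _ _ hw]
    rcases hs.comparable he with ⟨x, rfl, -⟩ | ⟨x, rfl, -⟩
    · rw [List.getElem_append_left]
    · rw [List.getElem_append_left]
  funext ζ i
  have hl := List.length_ofFn (f := fun j : Fin (N + M + i + 1) => ζ j)
  obtain ⟨q, ρ, hc, hq⟩ := hN (List.ofFn fun j : Fin (N + M + i + 1) => ζ j) (by omega)
  obtain ⟨q', ρ', hc', hq'⟩ := hM (List.ofFn fun j : Fin (N + M + i + 1) => ζ j) (by omega)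
  have he := congrFun h (along step (List.ofFn fun j : Fin (N + M + i + 1) => ζ j) t)
  rw [hs.induced_along hm hc, hs.induced_along hm hc'] at he
  rw [← cat_ofFn (N + M + i + 1) ζ, hc, hc']
  exact aux (by omega) (by omega) he

end IsSelfSimilar

end SelfSimilar

section Model

/-- Copies of the cone of `C_n`, indexed by `Sym(m)` and by `k + 1` further labels. -/
@[ext]
structure Model (m n k : ℕ) where
  perm : Equiv.Perm (Fin m)
  label : Option (Fin k)
  tail : ℕ → Fin n

variable {m n k : ℕ}

instance : MulAction (Equiv.Perm (Fin m)) (Model m n k) where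
  smul ρ y := ⟨ρ * y.perm, y.label, y.tail⟩
  one_smul y := Model.ext (one_mul y.perm) rfl rfl
  mul_smul ρ π y := Model.ext (mul_assoc ρ π y.perm) rfl rfl

theorem Model.smul_mk (ρ s : Equiv.Perm (Fin m)) (j : Option (Fin k)) (ζ : ℕ → Fin n) :
    ρ • (⟨s, j, ζ⟩ : Model m n k) = ⟨ρ * s, j, ζ⟩ :=
  rfl

/-- Identify a label in `Fin n ⊕ Fin k` with a cone: the cone of a letter in the copy labelled
`none`, or one of the other copies. -/
def place (x : Fin n ⊕ Fin k) : Option (Fin k) × List (Fin n) :=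
  x.elim (fun c => (none, [c])) fun j => (some j, [])

/-- The self-similarity of the model given by a bijection of labels. -/
def Model.step (β : Fin m × Option (Fin k) ≃ Fin n ⊕ Fin k) (a : Fin m) (y : Model m n k) :
    Model m n k :=
  ⟨y.perm, (place (β (y.perm⁻¹ a, y.label))).1,
    cat (place (β (y.perm⁻¹ a, y.label))).2 y.tail⟩

theorem place_inj {x x' : Fin n ⊕ Fin k} {ζ ξ : ℕ → Fin n}
    (h₁ : (place x).1 = (place x').1) (h₂ : cat (place x).2 ζ = cat (place x').2 ξ) :
    x = x' ∧ ζ = ξ := by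
  have hx : x = x' := by
    rcases x with c | j <;> rcases x' with c' | j'
    · simpa using eq_of_cat_eq (v := [c]) (w := [c']) rfl h₂
    · simp [place] at h₁
    · simp [place] at h₁
    · simpa [place] using h₁
  subst hx
  exact ⟨rfl, cat_injective _ h₂⟩

theorem place_surj (j : Option (Fin k)) (ζ : ℕ → Fin n) :
    ∃ x : Fin n ⊕ Fin k, ∃ ξ, (place x).1 = j ∧ cat (place x).2 ξ = ζ := by
  cases j with
  | none => exact ⟨.inl (ζ 0), _, rfl, cat_ofFn 1 ζ⟩
  | some j => exact ⟨.inr j, ζ, rfl, cat_nil ζ⟩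

theorem Model.isSelfSimilar (β : Fin m × Option (Fin k) ≃ Fin n ⊕ Fin k) :
    IsSelfSimilar (Model.step β) where
  inj := by
    rintro a b ⟨s, j, ζ⟩ ⟨s', j', ζ'⟩ h
    obtain ⟨h₁, h₂, h₃⟩ := Model.ext_iff.1 h
    simp only [step] at h₁ h₂ h₃
    subst h₁
    obtain ⟨hx, rfl⟩ := place_inj h₂ h₃
    obtain ⟨hab, rfl⟩ := Prod.ext_iff.1 (β.injective hx)
    exact ⟨(s⁻¹).injective hab, rfl⟩
  surj := by
    rintro ⟨s, j, ζ⟩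
    obtain ⟨x, ξ, rfl, rfl⟩ := place_surj j ζ
    refine ⟨s (β.symm x).1, ⟨s, (β.symm x).2, ξ⟩, ?_⟩
    simp [step]
  smul := by
    rintro ρ a ⟨s, j, ζ⟩
    simp [step, Model.smul_mk]

theorem Model.along_eq (β : Fin m × Option (Fin k) ≃ Fin n ⊕ Fin k) (p : List (Fin m))
    (s : Equiv.Perm (Fin m)) (j : Option (Fin k)) :
    ∃ j' w, ∀ ζ : ℕ → Fin n,
      along (Model.step β) p ⟨s, j, ζ⟩ = ⟨s, j', cat w ζ⟩ := by
  induction p with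
  | nil => exact ⟨j, [], fun ζ => by rw [cat_nil]; rfl⟩
  | cons a p ih =>
    obtain ⟨j', w, h⟩ := ih
    refine ⟨(place (β (s⁻¹ a, j'))).1, (place (β (s⁻¹ a, j'))).2 ++ w, fun ζ => ?_⟩
    change step β a (along (step β) p ⟨s, j, ζ⟩) = _
    rw [h, cat_append]
    rfl

/-- The induced map on the model locally replaces labels and prefixes. -/
theorem Model.induced_local (β : Fin m × Option (Fin k) ≃ Fin n ⊕ Fin k) (hm : 2 ≤ m)
    {f : (ℕ → Fin m) → (ℕ → Fin m)} (hf : HasCharts f) (y : Model m n k) :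
    ∃ w s' j' w', IsPref w y.tail ∧ ∀ ζ,
      induced (Model.step β) f ⟨y.perm, y.label, cat w ζ⟩ = ⟨s', j', cat w' ζ⟩ := by
  have hs := Model.isSelfSimilar β
  obtain ⟨N, hN⟩ := hf
  obtain ⟨p, ⟨s, j, ζ⟩, hp, rfl⟩ := hs.exists_along N y
  obtain ⟨q, ρ, hc⟩ := hN p hp
  obtain ⟨j₁, w₁, h₁⟩ := Model.along_eq (n := n) β p s j
  obtain ⟨j₂, w₂, h₂⟩ := Model.along_eq (n := n) β q (ρ * s) j
  rw [h₁]
  refine ⟨w₁, ρ * s, j₂, w₂, isPref_iff.2 ⟨ζ, rfl⟩, fun ξ => ?_⟩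
  rw [← h₁ ξ, hs.induced_along hm hc, ← h₂, Model.smul_mk]

/-- The embedding of the model in `C_n` as a union of cones of equal depth. -/
def Model.embed {N : ℕ} (e : Equiv.Perm (Fin m) × Option (Fin k) ↪ (Fin N → Fin n))
    (y : Model m n k) : ℕ → Fin n :=
  cat (List.ofFn (e (y.perm, y.label))) y.tail

theorem Model.embed_injective {N : ℕ}
    (e : Equiv.Perm (Fin m) × Option (Fin k) ↪ (Fin N → Fin n)) :
    Function.Injective (Model.embed e) := by
  rintro ⟨s, j, ζ⟩ ⟨s', j', ζ'⟩ h
  have h₁ : (s, j) = (s', j') :=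
    e.injective (List.ofFn_injective (eq_of_cat_eq (by simp) h))
  obtain ⟨rfl, rfl⟩ := Prod.mk.inj h₁
  exact Model.ext rfl rfl (cat_injective _ h)

/-- The map of `C_n` induced by the charts of `f`, extended by the identity. -/
noncomputable def extended {N : ℕ} (β : Fin m × Option (Fin k) ≃ Fin n ⊕ Fin k)
    (e : Equiv.Perm (Fin m) × Option (Fin k) ↪ (Fin N → Fin n))
    (f : (ℕ → Fin m) → (ℕ → Fin m)) : (ℕ → Fin n) → (ℕ → Fin n) :=
  Function.extend (Model.embed e) (Model.embed e ∘ induced (Model.step β) f) id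

variable {N : ℕ} {β : Fin m × Option (Fin k) ≃ Fin n ⊕ Fin k}
  {e : Equiv.Perm (Fin m) × Option (Fin k) ↪ (Fin N → Fin n)}

theorem extended_embed (f : (ℕ → Fin m) → (ℕ → Fin m)) (y : Model m n k) :
    extended β e f (Model.embed e y) = Model.embed e (induced (Model.step β) f y) :=
  (Model.embed_injective e).extend_apply _ _ y

theorem extended_of_notMem (f : (ℕ → Fin m) → (ℕ → Fin m)) {ζ : ℕ → Fin n}
    (h : ¬∃ y, Model.embed e y = ζ) : extended β e f ζ = ζ :=
  Function.extend_apply' _ _ _ h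

theorem extended_id (hm : 2 ≤ m) : extended β e id = id := by
  funext ζ
  by_cases h : ∃ y, Model.embed e y = ζ
  · obtain ⟨y, rfl⟩ := h
    rw [extended_embed, (Model.isSelfSimilar β).induced_id hm]
    rfl
  · exact extended_of_notMem id h

theorem extended_comp (hm : 2 ≤ m) {f g : (ℕ → Fin m) → (ℕ → Fin m)} (hf : HasCharts f)
    (hg : HasCharts g) : extended β e (g ∘ f) = extended β e g ∘ extended β e f := by
  funext ζ
  by_cases h : ∃ y, Model.embed e y = ζ
  · obtain ⟨y, rfl⟩ := h
    simp only [Function.comp_apply, extended_embed]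
    rw [(Model.isSelfSimilar β).induced_comp hm hf hg]
  · simp only [Function.comp_apply, extended_of_notMem _ h]

theorem eq_of_extended_eq (hm : 2 ≤ m) (ζ : ℕ → Fin n) {f g : (ℕ → Fin m) → (ℕ → Fin m)}
    (hf : HasCharts f) (hg : HasCharts g) (h : extended β e f = extended β e g) : f = g := by
  have : Nonempty (Model m n k) := ⟨⟨1, none, ζ⟩⟩
  refine (Model.isSelfSimilar β).eq_of_induced_eq hm hf hg (funext fun y => ?_)
  apply Model.embed_injective e
  rw [← extended_embed, h, extended_embed]

theorem isLocal_extended (hm : 2 ≤ m) {f : (ℕ → Fin m) → (ℕ → Fin m)} (hf : HasCharts f) :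
    IsLocal (extended β e f) := by
  intro ζ
  by_cases h : ∃ y, Model.embed e y = ζ
  · obtain ⟨y, rfl⟩ := h
    obtain ⟨w, s', j', w', hw, h⟩ := Model.induced_local β hm hf y
    obtain ⟨u, hu⟩ := isPref_iff.1 hw
    refine ⟨List.ofFn (e (y.perm, y.label)) ++ w, List.ofFn (e (s', j')) ++ w',
      isPref_iff.2 ⟨u, ?_⟩, fun v => ?_⟩
    · rw [cat_append, hu]
      rfl
    · have := extended_embed (β := β) (e := e) f ⟨y.perm, y.label, cat w v⟩
      rw [h] at this
      simpa only [Model.embed, cat_append] using this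
  · refine ⟨List.ofFn fun i : Fin N => ζ i, List.ofFn fun i : Fin N => ζ i,
      isPref_iff.2 ⟨_, cat_ofFn N ζ⟩, fun u => extended_of_notMem f ?_⟩
    rintro ⟨⟨s, j, ξ⟩, hy⟩
    apply h
    have hl := eq_of_cat_eq (by simp) hy
    refine ⟨⟨s, j, fun i => ζ (N + i)⟩, ?_⟩
    change cat (List.ofFn (e (s, j))) _ = ζ
    rw [hl, cat_ofFn]

/-- The homeomorphism of `C_n` induced by a homeomorphism of `C_m` with charts. -/
noncomputable def extendedHomeo (β : Fin m × Option (Fin k) ≃ Fin n ⊕ Fin k)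
    (e : Equiv.Perm (Fin m) × Option (Fin k) ↪ (Fin N → Fin n)) (hm : 2 ≤ m)
    (f : (ℕ → Fin m) ≃ₜ (ℕ → Fin m)) (hf : HasCharts f) (hf' : HasCharts f.symm) :
    (ℕ → Fin n) ≃ₜ (ℕ → Fin n) where
  toFun := extended β e f
  invFun := extended β e f.symm
  left_inv ζ := by
    have := congrFun (extended_comp (β := β) (e := e) hm hf hf') ζ
    rw [f.symm_comp_self, extended_id hm] at this
    exact this.symm
  right_inv ζ := by
    have := congrFun (extended_comp (β := β) (e := e) hm hf' hf) ζ
    rw [f.self_comp_symm, extended_id hm] at this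
    exact this.symm
  continuous_toFun := (isLocal_extended hm hf).continuous
  continuous_invFun := (isLocal_extended hm hf').continuous

end Model

/-- **Theorem 2 of the paper.** Let `m ≥ 2`, `n = k(m-1) + m` with
`k ≥ 1`, `G ≤ Sym(m)`, and let `H = G_ext ≤ Sym(n)` consist of the permutations
that agree with some `σ ∈ G` on `{0,…,m-1}` and fix `m, m+1, …, n-1`.  Then
`V_m(G)` embeds in `V_n(H)`. -/
theorem stmt10 (m n k : ℕ) (hm : 2 ≤ m) (hk : 1 ≤ k) (hn : n = k * (m - 1) + m)
    (G : Subgroup (Equiv.Perm (Fin m))) (H : Subgroup (Equiv.Perm (Fin n)))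
    (hH : ∀ π : Equiv.Perm (Fin n), π ∈ H ↔
      ∃ σ : Equiv.Perm (Fin m), σ ∈ G ∧
        (∀ (i : Fin n) (h : (i : ℕ) < m), ((π i : ℕ)) = ((σ ⟨i, h⟩ : Fin m) : ℕ)) ∧
        (∀ i : Fin n, m ≤ (i : ℕ) → π i = i)) :
    ∃ Φ : ((ℕ → Fin m) ≃ₜ (ℕ → Fin m)) → ((ℕ → Fin n) ≃ₜ (ℕ → Fin n)),
      (∀ f ∈ Vset m G, Φ f ∈ Vset n H) ∧
      Set.InjOn Φ (Vset m G) ∧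
      ∀ f ∈ Vset m G, ∀ g ∈ Vset m G, Φ (f.trans g) = (Φ f).trans (Φ g) := by
  have : NeZero m := ⟨by omega⟩
  have hn2 : 1 < n := by omega
  have hβ : Nonempty (Fin m × Option (Fin k) ≃ Fin n ⊕ Fin k) := by
    refine ⟨Fintype.equivOfCardEq ?_⟩
    obtain ⟨l, rfl⟩ : ∃ l, m = l + 1 := ⟨m - 1, by omega⟩
    simp [hn]
    ring
  obtain ⟨β⟩ := hβ
  have he : Nonempty (Equiv.Perm (Fin m) × Option (Fin k) ↪
      (Fin (Fintype.card (Equiv.Perm (Fin m) × Option (Fin k))) → Fin n)) := by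
    apply Function.Embedding.nonempty_of_card_le
    rw [Fintype.card_fun, Fintype.card_fin, Fintype.card_fin]
    exact (Nat.lt_pow_self hn2).le
  obtain ⟨e⟩ := he
  have hc : ∀ f ∈ Vset m G, HasCharts f ∧ HasCharts f.symm := fun f hf =>
    ⟨hasCharts_of_mem_Vset hf, hasCharts_of_mem_Vset (symm_mem_Vset hf)⟩
  have hΦ : ∀ f : (ℕ → Fin m) ≃ₜ (ℕ → Fin m), ∃ h : (ℕ → Fin n) ≃ₜ (ℕ → Fin n),
      HasCharts f ∧ HasCharts f.symm → ⇑h = extended β e f := by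
    intro f
    by_cases hf : HasCharts f ∧ HasCharts f.symm
    · exact ⟨extendedHomeo β e hm f hf.1 hf.2, fun _ => rfl⟩
    · exact ⟨Homeomorph.refl _, fun h => (hf h).elim⟩
  choose Φ hΦ using hΦ
  refine ⟨Φ, fun f hf => ?_, fun f hf g hg hfg => ?_, fun f hf g hg => ?_⟩
  · apply IsLocal.mem_Vset
    rw [hΦ f (hc f hf)]
    exact isLocal_extended hm (hc f hf).1
  · have h := congrArg DFunLike.coe hfg
    rw [hΦ f (hc f hf), hΦ g (hc g hg)] at h
    exact DFunLike.coe_injective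
      (eq_of_extended_eq hm (fun _ => ⟨0, by omega⟩) (hc f hf).1 (hc g hg).1 h)
  · have hcomp : HasCharts (f.trans g) ∧ HasCharts (f.trans g).symm :=
      ⟨(hc f hf).1.comp (hc g hg).1, (hc g hg).2.comp (hc f hf).2⟩
    apply DFunLike.coe_injective
    change ⇑(Φ (f.trans g)) = ⇑(Φ g) ∘ ⇑(Φ f)
    rw [hΦ _ hcomp, hΦ f (hc f hf), hΦ g (hc g hg)]
    exact extended_comp hm (hc f hf).1 (hc g hg).1

end Paper
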